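/- (Lemma 3, backbone lemma) Let F be a valid sequence of flips from T_start to T_end with directed acyclic graph D_F. Suppose a sequence of flips F⁻ has been performed such that every time an edge is flipped, the corresponding node is a source node of the DAG remaining from D_F after the preceding deletions, and it is deleted; let T be the triangulation resulting from performing F⁻ and let D be the remaining DAG. Let f_h be a node of D such that ε(f_h) is an edge of T. Then there is a source node f_s of D satisfying: (1) there is a walk W in T from ε(f_h) to ε(f_s); (2) there is a directed path B from f_s to f_h in D; (3) the length of W is at most the length of B; and (4) every edge in W is the underlying edge of a flip on B, that is, W = ⟨ε(v_1),…,ε(v_ℓ)⟩ where v_1 = f_s, …, v_ℓ = f_h are nodes of B and for each i = 1,…,ℓ−1 there is a directed path B_i from v_i to v_{i+1} contained in B. -/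

import Mathlib

noncomputable section

/-- Points of the Euclidean plane. -/
abbrev Pt : Type := EuclideanSpace ℝ (Fin 2)

/-- The closed segment spanned by an unordered pair of points. -/
def segOf : Sym2 Pt → Set Pt :=
  Sym2.lift ⟨fun p q => segment ℝ p q, fun _ _ => segment_symm ℝ _ _⟩

/-- The open segment (relative interior) spanned by an unordered pair of points. -/
def openSegOf : Sym2 Pt → Set Pt :=
  Sym2.lift ⟨fun p q => openSegment ℝ p q, fun _ _ => openSegment_symm ℝ _ _⟩

/-- A set of closed line segments (given by unordered pairs of distinct endpoints in `P`)
that pairwise intersect only in common endpoints and whose relative interiors contain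
no point of `P`. -/
def ValidEdgeSet (P : Set Pt) (T : Set (Sym2 Pt)) : Prop :=
  (∀ e ∈ T, ¬ e.IsDiag) ∧
  (∀ e ∈ T, ∀ x ∈ e, x ∈ P) ∧
  (∀ e ∈ T, ∀ f ∈ T, e ≠ f → ∀ x, x ∈ segOf e → x ∈ segOf f → x ∈ e ∧ x ∈ f) ∧
  (∀ e ∈ T, ∀ p ∈ P, p ∉ openSegOf e)

/-- A triangulation of `P`: a maximal valid edge set. -/
def IsTriangulation (P : Set Pt) (T : Set (Sym2 Pt)) : Prop :=
  ValidEdgeSet P T ∧ ∀ T', ValidEdgeSet P T' → T ⊆ T' → T' = T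

/-- `a`, `b`, `c` span a triangle of the triangulation `T` of `P`. -/
def IsTriangleOf (P : Set Pt) (T : Set (Sym2 Pt)) (a b c : Pt) : Prop :=
  s(a, b) ∈ T ∧ s(b, c) ∈ T ∧ s(a, c) ∈ T ∧
  ¬ Collinear ℝ ({a, b, c} : Set Pt) ∧
  ∀ p ∈ P, p ∈ convexHull ℝ ({a, b, c} : Set Pt) → p = a ∨ p = b ∨ p = c

/-- `e` is an edge of the triangle on `a`, `b`, `c`. -/
def EdgeOfTriangle (e : Sym2 Pt) (a b c : Pt) : Prop :=
  e = s(a, b) ∨ e = s(b, c) ∨ e = s(a, c)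

/-- Two edges share a triangle of the triangulation `T`. -/
def ShareTriangle (P : Set Pt) (T : Set (Sym2 Pt)) (e f : Sym2 Pt) : Prop :=
  ∃ a b c, IsTriangleOf P T a b c ∧ EdgeOfTriangle e a b c ∧ EdgeOfTriangle f a b c

/-- A set of points is in convex position. -/
def ConvexPosition (s : Set Pt) : Prop :=
  ∀ x ∈ s, x ∉ convexHull ℝ (s \ {x})

/-- A flip is recorded by its underlying edge `ε(f)` (first component) and its
resulting edge `φ(f)` (second component). -/
abbrev FlipData : Type := Sym2 Pt × Sym2 Pt

/-- The two triangles `abc` and `acd` of `T` incident to the edge `s(a,c)` form a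
convex quadrilateral with diagonal `s(a,c)` (the other diagonal being `s(b,d)`). -/
def IsFlipQuad (P : Set Pt) (T : Set (Sym2 Pt)) (a b c d : Pt) : Prop :=
  IsTriangleOf P T a b c ∧ IsTriangleOf P T a c d ∧ b ≠ d ∧
  ConvexPosition ({a, b, c, d} : Set Pt)

/-- The flip `f` is applicable in the triangulation `T` and transforms `T` into `T'`. -/
def FlipsTo (P : Set Pt) (T T' : Set (Sym2 Pt)) (f : FlipData) : Prop :=
  IsTriangulation P T ∧ f.1 ∈ T ∧
  ∃ a b c d, IsFlipQuad P T a b c d ∧ f.1 = s(a, c) ∧ f.2 = s(b, d) ∧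
    T' = (T \ {f.1}) ∪ {f.2}

/-- `F` is a valid sequence of flips transforming `T` into `T'`. -/
def ValidSeq (P : Set Pt) : Set (Sym2 Pt) → List FlipData → Set (Sym2 Pt) → Prop
  | T, [], T' => T = T'
  | T, f :: fs, T' => ∃ T₁, FlipsTo P T T₁ f ∧ ValidSeq P T₁ fs T'

/-- The flip distance between `T` and `T'` equals `k`. -/
def IsFlipDist (P : Set Pt) (T T' : Set (Sym2 Pt)) (k : ℕ) : Prop :=
  (∃ F : List FlipData, ValidSeq P T F T' ∧ F.length = k) ∧
  ∀ F : List FlipData, ValidSeq P T F T' → k ≤ F.length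

/-- Apply a list of flips (as set operations) to a triangulation. -/
def applyFlips : Set (Sym2 Pt) → List FlipData → Set (Sym2 Pt)
  | T, [] => T
  | T, f :: fs => applyFlips ((T \ {f.1}) ∪ {f.2}) fs

/-- The arc relation of the DAG `D_F` (on 0-based positions of the flips in `F`),
for a valid sequence `F` starting at `T₀`. -/
def Arc (P : Set Pt) (T₀ : Set (Sym2 Pt)) (F : List FlipData) (i j : ℕ) : Prop :=
  ∃ (hi : i < F.length) (hj : j < F.length), i < j ∧
    ((F.get ⟨i, hi⟩).2 = (F.get ⟨j, hj⟩).1 ∨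
      ShareTriangle P (applyFlips T₀ (F.take j)) (F.get ⟨i, hi⟩).2 (F.get ⟨j, hj⟩).1) ∧
    ∀ p, ∀ hp : p < F.length, i < p → p < j → (F.get ⟨p, hp⟩).1 ≠ (F.get ⟨i, hi⟩).2

/-- `F'` is a permutation of `F` that is a topological sorting of `D_F`. -/
def IsTopologicalSorting (P : Set Pt) (T₀ : Set (Sym2 Pt)) (F F' : List FlipData) : Prop :=
  ∃ (hlen : F'.length = F.length) (σ : Fin F.length ≃ Fin F.length),
    (∀ m : Fin F.length, F'.get (Fin.cast hlen.symm m) = F.get (σ m)) ∧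
    ∀ m n : Fin F.length, Arc P T₀ F (σ m) (σ n) → m < n


/-- The list `L` of (0-based) positions of flips of `F` records an order in which,
every time an edge is flipped, the corresponding node is a source node of the DAG
remaining from `D_F` after the preceding deletions (and is deleted). -/
def SourceElimOrder (P : Set Pt) (T₀ : Set (Sym2 Pt)) (F : List FlipData)
    (L : List ℕ) : Prop :=
  L.Nodup ∧ (∀ i ∈ L, i < F.length) ∧
  ∀ t, ∀ ht : t < L.length, ∀ j, Arc P T₀ F j (L.get ⟨t, ht⟩) → j ∈ L.take t

/-- The flips of `F` located at the positions listed in `L`, in the order of `L`. -/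
def flipsAt (F : List FlipData) (L : List ℕ) : List FlipData :=
  L.filterMap fun i => F[i]?

/-- The underlying edges of the flips of `F` located at the positions listed in `V`. -/
def underlyingEdges (F : List FlipData) (V : List ℕ) : List (Sym2 Pt) :=
  V.filterMap fun i => (F[i]?).map Prod.fst

/-! ### Signed areas and barycentric coordinates in the plane -/

/-- Twice the signed area of the triangle `a b c`. -/
def signedArea (a b c : Pt) : ℝ := (b 0 - a 0) * (c 1 - a 1) - (b 1 - a 1) * (c 0 - a 0)

lemma signedArea_comb (a b p q r : Pt) {x y z : ℝ} (h : x + y + z = 1) :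
    signedArea a b (x • p + y • q + z • r) =
      x * signedArea a b p + y * signedArea a b q + z * signedArea a b r := by
  obtain rfl : x = 1 - y - z := by linarith
  simp [signedArea]
  ring

lemma signedArea_comb_two (a b p q : Pt) {x y : ℝ} (h : x + y = 1) :
    signedArea a b (x • p + y • q) = x * signedArea a b p + y * signedArea a b q := by
  obtain rfl : x = 1 - y := by linarith
  simp [signedArea]
  ring

@[simp] lemma signedArea_left (a b : Pt) : signedArea a b a = 0 := by
  simp [signedArea]

@[simp] lemma signedArea_right (a b : Pt) : signedArea a b b = 0 := by
  simp [signedArea]; ring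

@[simp] lemma signedArea_self (a b : Pt) : signedArea a a b = 0 := by
  simp [signedArea]

lemma signedArea_rotate (a b c : Pt) : signedArea b c a = signedArea a b c := by
  simp [signedArea]; ring

lemma signedArea_swap (a b c : Pt) : signedArea b a c = -signedArea a b c := by
  simp [signedArea]; ring

lemma signedArea_swap_right (a b c : Pt) : signedArea a c b = -signedArea a b c := by
  simp [signedArea]; ring

lemma collinear_iff_signedArea_eq_zero (a b c : Pt) :
    Collinear ℝ ({a, b, c} : Set Pt) ↔ signedArea a b c = 0 := by
  rw [collinear_iff_of_mem (p₀ := a) (by simp)]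
  constructor
  · rintro ⟨v, hv⟩
    obtain ⟨r, rfl⟩ := hv b (by simp)
    obtain ⟨s, rfl⟩ := hv c (by simp)
    simp [signedArea]
    ring
  · intro h
    by_cases hab : b = a
    · refine ⟨c - a, ?_⟩
      simp only [Set.mem_insert_iff, Set.mem_singleton_iff, forall_eq_or_imp, forall_eq]
      exact ⟨⟨0, by simp⟩, ⟨0, by simp [hab]⟩, ⟨1, by simp⟩⟩
    · refine ⟨b - a, ?_⟩
      simp only [Set.mem_insert_iff, Set.mem_singleton_iff, forall_eq_or_imp, forall_eq]
      refine ⟨⟨0, by simp⟩, ⟨1, by simp⟩, ?_⟩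
      simp only [signedArea] at h
      by_cases h0 : b 0 - a 0 = 0
      · have h1 : b 1 - a 1 ≠ 0 := fun h1 => hab <| by
          ext i; fin_cases i
          · simpa [sub_eq_zero] using h0
          · simpa [sub_eq_zero] using h1
        refine ⟨(c 1 - a 1) / (b 1 - a 1), ?_⟩
        have h2 : c 0 - a 0 = 0 := by
          rw [h0] at h
          have : (b 1 - a 1) * (c 0 - a 0) = 0 := by linarith
          exact (mul_eq_zero.1 this).resolve_left h1
        ext i; fin_cases i
        · simp [h0]; linarith
        · simp; field_simp; ring
      · refine ⟨(c 0 - a 0) / (b 0 - a 0), ?_⟩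
        ext i; fin_cases i
        · simp; field_simp; ring
        · simp; field_simp; linarith

lemma exists_barycentric {a b c : Pt} (h : signedArea a b c ≠ 0) (v : Pt) :
    ∃ x y z : ℝ, x + y + z = 1 ∧ v = x • a + y • b + z • c := by
  refine ⟨signedArea v b c / signedArea a b c, signedArea a v c / signedArea a b c,
    signedArea a b v / signedArea a b c, ?_, ?_⟩
  · field_simp
    simp only [signedArea]
    ring
  · ext i; fin_cases i
    · simp; field_simp; simp only [signedArea]; ring
    · simp; field_simp; simp only [signedArea]; ring

lemma mem_convexHull_triple {a b c p : Pt} :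
    p ∈ convexHull ℝ ({a, b, c} : Set Pt) ↔
      ∃ x y z : ℝ, 0 ≤ x ∧ 0 ≤ y ∧ 0 ≤ z ∧ x + y + z = 1 ∧ x • a + y • b + z • c = p := by
  constructor
  · rw [convexHull_insert (by simp), mem_convexJoin]
    rintro ⟨a', ha', q, hq, hp⟩
    rw [Set.mem_singleton_iff] at ha'
    subst ha'
    rw [convexHull_pair] at hq
    obtain ⟨u, v, hu, hv, huv, rfl⟩ := hq
    obtain ⟨s, t, hs, ht, hst, rfl⟩ := hp
    refine ⟨s, t * u, t * v, hs, mul_nonneg ht hu, mul_nonneg ht hv, ?_, by module⟩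
    linear_combination hst + t * huv
  · rintro ⟨x, y, z, hx, hy, hz, h, rfl⟩
    have hc := convex_convexHull ℝ ({a, b, c} : Set Pt)
    have ha : a ∈ convexHull ℝ ({a, b, c} : Set Pt) := subset_convexHull ℝ _ (by simp)
    have hb : b ∈ convexHull ℝ ({a, b, c} : Set Pt) := subset_convexHull ℝ _ (by simp)
    have hc' : c ∈ convexHull ℝ ({a, b, c} : Set Pt) := subset_convexHull ℝ _ (by simp)
    have := hc.sum_mem (t := Finset.univ) (w := ![x, y, z]) (z := ![a, b, c])
      (by simp [Fin.forall_fin_succ, hx, hy, hz]) (by simpa [Fin.sum_univ_succ, add_assoc] using h)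
      (by simp [Fin.forall_fin_succ, ha, hb, hc'])
    simpa [Fin.sum_univ_succ, add_assoc] using this

lemma mem_segOf {a b p : Pt} :
    p ∈ segOf s(a, b) ↔ ∃ x y : ℝ, 0 ≤ x ∧ 0 ≤ y ∧ x + y = 1 ∧ x • a + y • b = p :=
  Iff.rfl

lemma mem_openSegOf {a b p : Pt} :
    p ∈ openSegOf s(a, b) ↔ ∃ x y : ℝ, 0 < x ∧ 0 < y ∧ x + y = 1 ∧ x • a + y • b = p :=
  Iff.rfl

/-! ### Triangles of a valid edge set -/

section Triangles

variable {P : Set Pt} {T : Set (Sym2 Pt)} {a b c : Pt}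

lemma IsTriangleOf.signedArea_ne_zero (h : IsTriangleOf P T a b c) : signedArea a b c ≠ 0 :=
  fun h0 => h.2.2.2.1 ((collinear_iff_signedArea_eq_zero a b c).2 h0)

lemma IsTriangleOf.swap_left (h : IsTriangleOf P T a b c) : IsTriangleOf P T b a c := by
  obtain ⟨h1, h2, h3, h4, h5⟩ := h
  rw [Set.insert_comm] at h4 h5
  exact ⟨Sym2.eq_swap ▸ h1, h3, h2, h4, fun p hp hm => by have := h5 p hp hm; tauto⟩

lemma IsTriangleOf.swap_right (h : IsTriangleOf P T a b c) : IsTriangleOf P T a c b := by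
  obtain ⟨h1, h2, h3, h4, h5⟩ := h
  rw [Set.pair_comm] at h4 h5
  exact ⟨h3, Sym2.eq_swap ▸ h2, h1, h4, fun p hp hm => by have := h5 p hp hm; tauto⟩

lemma edgeOfTriangle_swap_left {e : Sym2 Pt} :
    EdgeOfTriangle e a b c ↔ EdgeOfTriangle e b a c := by
  simp only [EdgeOfTriangle, Sym2.eq_swap (a := a) (b := b)]
  tauto

lemma edgeOfTriangle_swap_right {e : Sym2 Pt} :
    EdgeOfTriangle e a b c ↔ EdgeOfTriangle e a c b := by
  simp only [EdgeOfTriangle, Sym2.eq_swap (a := b) (b := c)]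
  tauto

lemma ShareTriangle.symm {e f : Sym2 Pt} (h : ShareTriangle P T e f) : ShareTriangle P T f e := by
  obtain ⟨a, b, c, h1, h2, h3⟩ := h
  exact ⟨a, b, c, h1, h3, h2⟩

lemma ShareTriangle.left_mem {e f : Sym2 Pt} (h : ShareTriangle P T e f) : e ∈ T := by
  obtain ⟨a, b, c, h1, rfl | rfl | rfl, h3⟩ := h
  exacts [h1.1, h1.2.1, h1.2.2.1]

/-- A triangle with a given edge can be put in the form `x, y, v` with that edge `s(x, y)`. -/
lemma ShareTriangle.exists_apex {x y : Pt} {f : Sym2 Pt} (h : ShareTriangle P T s(x, y) f) :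
    ∃ v, IsTriangleOf P T x y v ∧ EdgeOfTriangle f x y v := by
  obtain ⟨a, b, c, h1, h2, h3⟩ := h
  rcases h2 with h2 | h2 | h2 <;> rcases Sym2.eq_iff.1 h2 with ⟨rfl, rfl⟩ | ⟨rfl, rfl⟩
  · exact ⟨_, h1, h3⟩
  · exact ⟨_, h1.swap_left, edgeOfTriangle_swap_left.1 h3⟩
  · exact ⟨_, h1.swap_left.swap_right,
      edgeOfTriangle_swap_right.1 (edgeOfTriangle_swap_left.1 h3)⟩
  · exact ⟨_, h1.swap_right.swap_left.swap_right,
      edgeOfTriangle_swap_right.1 (edgeOfTriangle_swap_left.1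
        (edgeOfTriangle_swap_right.1 h3))⟩
  · exact ⟨_, h1.swap_right, edgeOfTriangle_swap_right.1 h3⟩
  · exact ⟨_, h1.swap_right.swap_left,
      edgeOfTriangle_swap_left.1 (edgeOfTriangle_swap_right.1 h3)⟩

/-- Two triangles of a valid edge set on the same side of a common edge coincide. -/
lemma apex_eq_of_same_side (hT : ValidEdgeSet P T) {v w : Pt} (hv : IsTriangleOf P T a b v)
    (hw : IsTriangleOf P T a b w) {x y z : ℝ} (hsum : x + y + z = 1) (hz : 0 < z)
    (hwv : w = x • a + y • b + z • v) : v = w := by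
  have hv0 := hv.signedArea_ne_zero
  have hw0 := hw.signedArea_ne_zero
  have hab : a ≠ b := by rintro rfl; simp at hv0
  have hav : v ≠ a := by rintro rfl; simp at hv0
  have hbv : v ≠ b := by rintro rfl; simp at hv0
  have haw : w ≠ a := by rintro rfl; simp at hw0
  have hbw : w ≠ b := by rintro rfl; simp at hw0
  have hvP : v ∈ P := hT.2.1 _ hv.2.1 _ (by simp)
  have hwP : w ∈ P := hT.2.1 _ hw.2.1 _ (by simp)
  have key : ∀ {a b : Pt} {x y : ℝ}, s(b, v) ∈ T → s(a, w) ∈ T → a ≠ b → v ≠ a → w ≠ b →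
      x + y + z = 1 → w = x • a + y • b + z • v → x ≤ 0 → 0 ≤ y → v = w := by
    intro a b x y hbv haw hab hav hbw hsum hwv hx hy
    by_contra hne
    have hd : (1 - x) ≠ 0 := by linarith
    have h1 : (y / (1 - x)) • b + (z / (1 - x)) • v ∈ segOf s(b, v) :=
      mem_segOf.2 ⟨_, _, div_nonneg hy (by linarith), div_nonneg hz.le (by linarith),
        by field_simp; linarith, rfl⟩
    have h2 : (y / (1 - x)) • b + (z / (1 - x)) • v ∈ segOf s(a, w) := by
      refine mem_segOf.2 ⟨-x / (1 - x), 1 / (1 - x), div_nonneg (by linarith) (by linarith),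
        div_nonneg (by linarith) (by linarith), by field_simp; ring, ?_⟩
      rw [hwv]
      match_scalars <;> field_simp
      ring
    have hne' : s(b, v) ≠ s(a, w) := by
      rw [Ne, Sym2.eq_iff]
      rintro (⟨h, -⟩ | ⟨h, -⟩)
      exacts [hab h.symm, hbw h.symm]
    obtain ⟨m1, m2⟩ := hT.2.2.1 _ hbv _ haw hne' _ h1 h2
    rw [Sym2.mem_iff] at m1 m2
    rcases m1 with m1 | m1 <;> rcases m2 with m2 | m2 <;> rw [m1] at m2
    exacts [hab m2.symm, hbw m2.symm, hav m2, hne m2]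
  by_cases hx : x ≤ 0
  · by_cases hy : y ≤ 0
    · have hmem : v ∈ convexHull ℝ ({a, b, w} : Set Pt) := by
        refine mem_convexHull_triple.2 ⟨-x / z, -y / z, 1 / z, div_nonneg (by linarith) hz.le,
          div_nonneg (by linarith) hz.le, by positivity, by field_simp; linarith, ?_⟩
        rw [hwv]
        match_scalars <;> field_simp <;> ring
      rcases hw.2.2.2.2 v hvP hmem with h | h | h
      exacts [absurd h hav, absurd h hbv, h]
    · exact key hv.2.1 hw.2.2.1 hab hav hbw hsum hwv hx (by linarith)
  · by_cases hy : y ≤ 0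
    · exact key (x := y) (y := x) hv.2.2.1 hw.2.1 hab.symm hbv haw (by linarith)
        (by rw [hwv]; abel) hy
        (by linarith)
    · have hmem : w ∈ convexHull ℝ ({a, b, v} : Set Pt) :=
        mem_convexHull_triple.2 ⟨x, y, z, by linarith, by linarith, hz.le, hsum, hwv.symm⟩
      rcases hv.2.2.2.2 w hwP hmem with h | h | h
      exacts [absurd h haw, absurd h hbw, h.symm]

/-- If an edge through a point in the interior of a triangle starts at `u`, then `u` is a vertex
of this triangle. -/
lemma endpoint_mem_of_meets_interior (hT : ValidEdgeSet P T) (h : IsTriangleOf P T a b c)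
    {u v : Pt} (he : s(u, v) ∈ T) (hne : ¬ EdgeOfTriangle s(u, v) a b c) {x y z : ℝ}
    (hx : 0 < x) (hy : 0 < y) (hz : 0 < z) (hsum : x + y + z = 1)
    (hp : x • a + y • b + z • c ∈ segOf s(u, v)) : u = a ∨ u = b ∨ u = c := by
  obtain ⟨α, β, hα, hβ, hαβ, hp⟩ := mem_segOf.1 hp
  have huP : u ∈ P := hT.2.1 _ he _ (by simp)
  have huv : u ≠ v := fun hd => hT.1 _ he (by simpa using hd)
  obtain ⟨x', y', z', hsum', hu⟩ := exists_barycentric h.signedArea_ne_zero u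
  let g : ℝ → ℝ := fun r => min ((1 - r) * x + r * x')
    (min ((1 - r) * y + r * y') ((1 - r) * z + r * z'))
  have hg : Continuous g := by fun_prop
  by_cases hpos : 0 < x' ∧ 0 < y' ∧ 0 < z'
  · exact h.2.2.2.2 u huP (mem_convexHull_triple.2
      ⟨x', y', z', hpos.1.le, hpos.2.1.le, hpos.2.2.le, hsum', hu.symm⟩)
  have hg0 : 0 ≤ g 0 := by simp [g, hx.le, hy.le, hz.le]
  have hg1 : g 1 ≤ 0 := by
    by_contra hcon
    apply hpos
    simpa [g] using hcon
  obtain ⟨r, ⟨hr0, hr1⟩, hr⟩ := intermediate_value_Icc' zero_le_one hg.continuousOn ⟨hg1, hg0⟩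
  have hr0' : r ≠ 0 := by
    rintro rfl
    have : 0 < g 0 := by simp [g, hx, hy, hz]
    linarith
  have hX : 0 ≤ (1 - r) * x + r * x' := hr ▸ min_le_left _ _
  have hY : 0 ≤ (1 - r) * y + r * y' := hr ▸ (min_le_right _ _).trans (min_le_left _ _)
  have hZ : 0 ≤ (1 - r) * z + r * z' := hr ▸ (min_le_right _ _).trans (min_le_right _ _)
  have hS : ((1 - r) * x + r * x') + ((1 - r) * y + r * y') + ((1 - r) * z + r * z') = 1 := by
    linear_combination (1 - r) * hsum + r * hsum'
  obtain ⟨q, hq⟩ : ∃ q : Pt, q = ((1 - r) * α + r) • u + ((1 - r) * β) • v := ⟨_, rfl⟩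
  have hq' : q = ((1 - r) * x + r * x') • a + ((1 - r) * y + r * y') • b
      + ((1 - r) * z + r * z') • c := by
    have : q = (1 - r) • (α • u + β • v) + r • u := by rw [hq]; module
    rw [this, hp]
    nth_rw 1 [hu]
    module
  have hqe : q ∈ segOf s(u, v) := mem_segOf.2 ⟨_, _, by nlinarith, by nlinarith,
    by linear_combination (1 - r) * hαβ, hq.symm⟩
  have fin : ∀ f : Sym2 Pt, f ∈ T → s(u, v) ≠ f → q ∈ segOf f → u ∈ f := by
    intro f hf hef hqf
    obtain ⟨m1, m2⟩ := hT.2.2.1 _ he _ hf hef _ hqe hqf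
    rcases Sym2.mem_iff.1 m1 with m1 | m1
    · rwa [← m1]
    · exfalso
      rw [m1] at hq
      have h0 : ((1 - r) * α + r) • (v - u) = 0 := by
        have hs : (1 - r) * β = 1 - ((1 - r) * α + r) := by linear_combination (1 - r) * hαβ
        rw [hs] at hq
        have h1 : v - (((1 - r) * α + r) • u + (1 - ((1 - r) * α + r)) • v) = 0 :=
          sub_eq_zero.2 hq
        rw [← h1]
        module
      rcases smul_eq_zero.1 h0 with h0 | h0
      · have : 0 ≤ (1 - r) * α := mul_nonneg (by linarith) hα
        exact hr0' (by linarith)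
      · exact huv (sub_eq_zero.1 h0).symm
  have hcase : (1 - r) * x + r * x' = 0 ∨ (1 - r) * y + r * y' = 0 ∨ (1 - r) * z + r * z' = 0 := by
    have h1 : g r = 0 := hr
    rcases min_choice ((1 - r) * x + r * x')
      (min ((1 - r) * y + r * y') ((1 - r) * z + r * z')) with h | h
    · exact Or.inl (h ▸ h1)
    · rcases min_choice ((1 - r) * y + r * y') ((1 - r) * z + r * z') with h' | h'
      · exact Or.inr (Or.inl (by rw [← h', ← h]; exact h1))
      · exact Or.inr (Or.inr (by rw [← h', ← h]; exact h1))
  rcases hcase with h0 | h0 | h0 <;> rw [h0] at hq' hS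
  · have := fin s(b, c) h.2.1 (fun h => hne (Or.inr (Or.inl h)))
      (mem_segOf.2 ⟨_, _, hY, hZ, by linarith, by rw [hq']; simp⟩)
    rw [Sym2.mem_iff] at this
    tauto
  · have := fin s(a, c) h.2.2.1 (fun h => hne (Or.inr (Or.inr h)))
      (mem_segOf.2 ⟨_, _, hX, hZ, by linarith, by rw [hq']; simp⟩)
    rw [Sym2.mem_iff] at this
    tauto
  · have := fin s(a, b) h.1 (fun h => hne (Or.inl h))
      (mem_segOf.2 ⟨_, _, hX, hY, by linarith, by rw [hq']; simp⟩)
    rw [Sym2.mem_iff] at this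
    tauto

/-- An edge of a valid edge set meets a triangle of which it is not an edge only in vertices. -/
lemma eq_vertex_of_mem_seg_of_mem_triangle (hT : ValidEdgeSet P T) (h : IsTriangleOf P T a b c)
    {e : Sym2 Pt} (he : e ∈ T) (hne : ¬ EdgeOfTriangle e a b c) {p : Pt} (hpe : p ∈ segOf e)
    (hp : p ∈ convexHull ℝ ({a, b, c} : Set Pt)) : p = a ∨ p = b ∨ p = c := by
  obtain ⟨x, y, z, hx, hy, hz, hsum, rfl⟩ := mem_convexHull_triple.1 hp
  obtain ⟨p, hpdef⟩ : ∃ p, p = x • a + y • b + z • c := ⟨_, rfl⟩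
  rw [← hpdef] at hpe ⊢
  have fin : ∀ f : Sym2 Pt, f ∈ T → e ≠ f → p ∈ segOf f → p ∈ f := fun f hf hef hpf =>
    (hT.2.2.1 _ he _ hf hef _ hpe hpf).2
  rcases hx.eq_or_lt with rfl | hx
  · have := fin s(b, c) h.2.1 (fun h => hne (Or.inr (Or.inl h)))
      (mem_segOf.2 ⟨_, _, hy, hz, by linarith, by rw [hpdef]; simp⟩)
    rw [Sym2.mem_iff] at this
    tauto
  rcases hy.eq_or_lt with rfl | hy
  · have := fin s(a, c) h.2.2.1 (fun h => hne (Or.inr (Or.inr h)))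
      (mem_segOf.2 ⟨_, _, hx.le, hz, by linarith, by rw [hpdef]; simp⟩)
    rw [Sym2.mem_iff] at this
    tauto
  rcases hz.eq_or_lt with rfl | hz
  · have := fin s(a, b) h.1 (fun h => hne (Or.inl h))
      (mem_segOf.2 ⟨_, _, hx.le, hy.le, by linarith, by rw [hpdef]; simp⟩)
    rw [Sym2.mem_iff] at this
    tauto
  exfalso
  induction e using Sym2.ind with
  | _ u v =>
    rw [hpdef] at hpe
    have hu := endpoint_mem_of_meets_interior hT h he hne hx hy hz hsum hpe
    rw [Sym2.eq_swap] at he hne hpe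
    have hv := endpoint_mem_of_meets_interior hT h he hne hx hy hz hsum hpe
    have huv : u ≠ v := fun hd => hT.1 _ he (by simpa using hd.symm)
    apply hne
    rcases hu with rfl | rfl | rfl <;> rcases hv with rfl | rfl | rfl <;>
      simp [EdgeOfTriangle] at huv ⊢

end Triangles

/-! ### Flip quadrilaterals -/

/-- The intrinsic (triangulation-independent) part of a flip: `a`, `b`, `c`, `d` is a convex
quadrilateral whose halves `abc` and `acd` contain no further point of `P`. -/
structure FlipQuad (P : Set Pt) (a b c d : Pt) : Prop where
  area_ne : signedArea a b c ≠ 0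
  cross : ∃ s t : ℝ, 0 < s ∧ s < 1 ∧ 0 < t ∧ t < 1 ∧
    s • a + (1 - s) • c = t • b + (1 - t) • d
  empty_left : ∀ p ∈ P, p ∈ convexHull ℝ ({a, b, c} : Set Pt) → p = a ∨ p = b ∨ p = c
  empty_right : ∀ p ∈ P, p ∈ convexHull ℝ ({a, c, d} : Set Pt) → p = a ∨ p = c ∨ p = d

/-- The edges of the two halves of the quadrilateral `a b c d` cut along `s(a, c)`. -/
def halfEdges (a b c d : Pt) : Set (Sym2 Pt) :=
  {s(a, b), s(b, c), s(c, d), s(a, d), s(a, c)}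

lemma mem_halfEdges {a b c d : Pt} {e : Sym2 Pt} : e ∈ halfEdges a b c d ↔
    e = s(a, b) ∨ e = s(b, c) ∨ e = s(c, d) ∨ e = s(a, d) ∨ e = s(a, c) := by
  simp [halfEdges]

namespace FlipQuad

variable {P : Set Pt} {T : Set (Sym2 Pt)} {a b c d : Pt}

lemma mem_halves {a b c d p : Pt} {s t : ℝ} (hs0 : 0 < s) (hs1 : s < 1) (ht0 : 0 < t)
    (ht1 : t < 1) (h : s • a + (1 - s) • c = t • b + (1 - t) • d)
    (hp : p ∈ convexHull ℝ ({b, d, a} : Set Pt)) :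
    p ∈ convexHull ℝ ({a, b, c} : Set Pt) ∨ p ∈ convexHull ℝ ({a, c, d} : Set Pt) := by
  obtain ⟨y, z, x, hy, hz, hx, hsum, rfl⟩ := mem_convexHull_triple.1 hp
  have ht1' : 0 < 1 - t := by linarith
  have hs1' : 0 < 1 - s := by linarith
  by_cases hc : z * t ≤ y * (1 - t)
  · left
    refine mem_convexHull_triple.2 ⟨x + z * s / (1 - t), y - z * t / (1 - t),
      z * (1 - s) / (1 - t), by positivity, ?_, by positivity, ?_, ?_⟩
    · rw [sub_nonneg, div_le_iff₀ ht1']; exact hc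
    · field_simp; linear_combination (1 - t) * hsum
    · have : d = (1 / (1 - t)) • (s • a + (1 - s) • c - t • b) := by
        rw [h]; match_scalars <;> field_simp
        ring
      rw [this]
      match_scalars <;> field_simp <;> ring
  · right
    push Not at hc
    refine mem_convexHull_triple.2 ⟨x + y * s / t, y * (1 - s) / t,
      z - y * (1 - t) / t, by positivity, by positivity, ?_, ?_, ?_⟩
    · rw [sub_nonneg, div_le_iff₀ ht0]; exact hc.le
    · field_simp; linear_combination t * hsum
    · have : b = (1 / t) • (s • a + (1 - s) • c - (1 - t) • d) := by
        rw [h]; match_scalars <;> field_simp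
        ring
      rw [this]
      match_scalars <;> field_simp <;> ring

lemma area_right (h : FlipQuad P a b c d) : signedArea a c d ≠ 0 := by
  obtain ⟨s, t, hs0, hs1, ht0, ht1, hst⟩ := h.cross
  intro h0
  have := congrArg (signedArea a c) hst
  rw [signedArea_comb_two _ _ _ _ (by ring), signedArea_comb_two _ _ _ _ (by ring)] at this
  simp only [signedArea_left, signedArea_right, h0] at this
  have h1 : signedArea a c b = 0 := by
    have : t * signedArea a c b = 0 := by linarith
    exact (mul_eq_zero.1 this).resolve_left ht0.ne'
  apply h.area_ne
  rw [signedArea_swap_right] at h1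
  linarith

lemma area_bcd (h : FlipQuad P a b c d) : signedArea b c d ≠ 0 := by
  obtain ⟨s, t, hs0, hs1, ht0, ht1, hst⟩ := h.cross
  intro h0
  have := congrArg (signedArea b c) hst
  rw [signedArea_comb_two _ _ _ _ (by ring), signedArea_comb_two _ _ _ _ (by ring)] at this
  simp only [signedArea_left, signedArea_right, h0, signedArea_rotate a b c] at this
  have : s * signedArea a b c = 0 := by linarith
  exact h.area_ne ((mul_eq_zero.1 this).resolve_left hs0.ne')

/-- The quadrilateral seen from its other diagonal. -/
lemma rotate (h : FlipQuad P a b c d) : FlipQuad P b c d a := by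
  obtain ⟨s, t, hs0, hs1, ht0, ht1, hst⟩ := h.cross
  have hA := h.area_ne
  have hB := h.area_bcd
  have hcross : t • b + (1 - t) • d = (1 - s) • c + (1 - (1 - s)) • a := by
    rw [← hst]; module
  have hrel : s * signedArea b d a + (1 - s) * signedArea b d c = 0 := by
    have := congrArg (signedArea b d) hst
    rw [signedArea_comb_two _ _ _ _ (by ring), signedArea_comb_two _ _ _ _ (by ring)] at this
    simpa using this
  have hne : signedArea b d c ≠ 0 := by
    rwa [signedArea_swap_right, neg_ne_zero]
  have hne' : signedArea b d a ≠ 0 := by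
    intro h0
    rw [h0] at hrel
    have : (1 - s) * signedArea b d c = 0 := by linarith
    exact hne ((mul_eq_zero.1 this).resolve_left (by linarith))
  have hneg : signedArea b d a * signedArea b d c < 0 := by
    have hsq : 0 < (1 - s) * (signedArea b d c * signedArea b d c) :=
      mul_pos (by linarith) (mul_self_pos.2 hne)
    have : s * (signedArea b d a * signedArea b d c) < 0 := by
      have := congrArg (· * signedArea b d c) hrel
      simp only [zero_mul] at this
      linarith
    by_contra hcon
    push Not at hcon
    nlinarith
  refine ⟨hB, ⟨t, 1 - s, ht0, ht1, by linarith, by linarith, hcross⟩, ?_, ?_⟩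
  · intro p hp hmem
    have hpa : p ≠ a := by
      rintro rfl
      obtain ⟨x, y, z, hx, hy, hz, hsum, heq⟩ := mem_convexHull_triple.1 hmem
      have := congrArg (signedArea b d) heq
      rw [signedArea_comb _ _ _ _ _ hsum, signedArea_left, signedArea_right] at this
      rw [← this] at hneg
      nlinarith [mul_nonneg hy (mul_self_nonneg (signedArea b d c))]
    have hmem' : p ∈ convexHull ℝ ({d, b, c} : Set Pt) := by
      convert hmem using 2
      ext q; simp only [Set.mem_insert_iff, Set.mem_singleton_iff]; tauto
    rcases mem_halves (a := c) (b := d) (c := a) (d := b) (s := 1 - s) (t := 1 - t)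
      (by linarith) (by linarith) (by linarith) (by linarith)
      (by rw [← sub_eq_zero] at hst ⊢; rw [← hst]; module) hmem' with h1 | h1
    · have := h.empty_right p hp (by
        convert h1 using 2
        ext q; simp only [Set.mem_insert_iff, Set.mem_singleton_iff]; tauto)
      tauto
    · have := h.empty_left p hp (by
        convert h1 using 2
        ext q; simp only [Set.mem_insert_iff, Set.mem_singleton_iff]; tauto)
      tauto
  · intro p hp hmem
    have hpc : p ≠ c := by
      rintro rfl
      obtain ⟨x, y, z, hx, hy, hz, hsum, heq⟩ := mem_convexHull_triple.1 hmem
      have := congrArg (signedArea b d) heq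
      rw [signedArea_comb _ _ _ _ _ hsum, signedArea_left, signedArea_right] at this
      rw [← this] at hneg
      nlinarith [mul_nonneg hz (mul_self_nonneg (signedArea b d a))]
    rcases mem_halves hs0 hs1 ht0 ht1 hst hmem with h1 | h1
    · have := h.empty_left p hp h1
      tauto
    · have := h.empty_right p hp h1
      tauto

lemma isTriangleOf_left (h : FlipQuad P a b c d) (hsub : halfEdges a b c d ⊆ T) :
    IsTriangleOf P T a b c :=
  ⟨hsub (by simp [halfEdges]), hsub (by simp [halfEdges]), hsub (by simp [halfEdges]),
    fun hc => h.area_ne ((collinear_iff_signedArea_eq_zero a b c).1 hc), h.empty_left⟩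

lemma isTriangleOf_right (h : FlipQuad P a b c d) (hsub : halfEdges a b c d ⊆ T) :
    IsTriangleOf P T a c d :=
  ⟨hsub (by simp [halfEdges]), hsub (by simp [halfEdges]), hsub (by simp [halfEdges]),
    fun hc => h.area_right ((collinear_iff_signedArea_eq_zero a c d).1 hc), h.empty_right⟩

lemma ne_diag (h : FlipQuad P a b c d) : a ≠ b ∧ b ≠ c ∧ a ≠ c ∧ c ≠ d ∧ a ≠ d ∧ b ≠ d := by
  have h1 := h.area_ne
  have h2 := h.area_right
  have h3 := h.area_bcd
  refine ⟨?_, ?_, ?_, ?_, ?_, ?_⟩ <;> rintro rfl <;> simp_all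

/-- The triangles incident to the diagonal are exactly the two halves. -/
lemma eq_apex (h : FlipQuad P a b c d) (hT : ValidEdgeSet P T) (hsub : halfEdges a b c d ⊆ T)
    {v : Pt} (hv : IsTriangleOf P T a c v) : v = b ∨ v = d := by
  have h1 := (h.isTriangleOf_left hsub).swap_right
  have h2 := h.isTriangleOf_right hsub
  obtain ⟨s, t, hs0, hs1, ht0, ht1, hst⟩ := h.cross
  obtain ⟨x, y, z, hsum, hvb⟩ := exists_barycentric h1.signedArea_ne_zero v
  rcases lt_trichotomy z 0 with hz | hz | hz
  · right
    have ht1' : 0 < 1 - t := by linarith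
    refine (apex_eq_of_same_side hT h2 hv (x := x + z * s / t) (y := y + z * (1 - s) / t)
      (z := - z * (1 - t) / t) ?_ (div_pos (by nlinarith) ht0) ?_).symm
    · field_simp; linear_combination t * hsum
    · have : b = (1 / t) • (s • a + (1 - s) • c - (1 - t) • d) := by
        rw [hst]; match_scalars <;> field_simp
        ring
      rw [hvb, this]
      match_scalars <;> field_simp
  · exfalso
    apply hv.signedArea_ne_zero
    rw [hvb, signedArea_comb _ _ _ _ _ hsum, hz]
    simp
  · exact Or.inl (apex_eq_of_same_side hT h1 hv hsum hz hvb).symm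

lemma shareTriangle_iff (h : FlipQuad P a b c d) (hT : ValidEdgeSet P T)
    (hsub : halfEdges a b c d ⊆ T) {e : Sym2 Pt} :
    ShareTriangle P T s(a, c) e ↔ e ∈ halfEdges a b c d := by
  rw [mem_halfEdges]
  constructor
  · intro hs
    obtain ⟨v, hv, he⟩ := hs.exists_apex
    rcases h.eq_apex hT hsub hv with rfl | rfl
    · rw [EdgeOfTriangle, Sym2.eq_swap (a := c)] at he
      tauto
    · rw [EdgeOfTriangle] at he
      tauto
  · intro he
    by_cases hl : EdgeOfTriangle e a b c
    · exact ⟨a, b, c, h.isTriangleOf_left hsub, Or.inr (Or.inr rfl), hl⟩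
    · refine ⟨a, c, d, h.isTriangleOf_right hsub, Or.inl rfl, ?_⟩
      rw [EdgeOfTriangle] at hl ⊢
      tauto

lemma crossing_mem (h : FlipQuad P a b c d) :
    ∃ p, p ∈ segOf s(a, c) ∧ p ∈ segOf s(b, d) ∧ p ≠ a ∧ p ≠ c := by
  obtain ⟨s, t, hs0, hs1, ht0, ht1, hst⟩ := h.cross
  have hne := h.ne_diag.2.2.1
  refine ⟨s • a + (1 - s) • c, mem_segOf.2 ⟨s, 1 - s, hs0.le, by linarith, by ring, rfl⟩,
    mem_segOf.2 ⟨t, 1 - t, ht0.le, by linarith, by ring, hst.symm⟩, ?_, ?_⟩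
  · intro he
    have : (1 - s) • (c - a) = 0 := by
      rw [← sub_eq_zero] at he; rw [← he]; module
    rcases smul_eq_zero.1 this with h0 | h0
    · linarith
    · exact hne (sub_eq_zero.1 h0).symm
  · intro he
    have : s • (a - c) = 0 := by
      rw [← sub_eq_zero] at he; rw [← he]; module
    rcases smul_eq_zero.1 this with h0 | h0
    · linarith
    · exact hne (sub_eq_zero.1 h0)

lemma diag_ne_diag (h : FlipQuad P a b c d) : s(a, c) ≠ s(b, d) := by
  have := h.ne_diag
  rw [Ne, Sym2.eq_iff]
  tauto

lemma diag_notMem (h : FlipQuad P a b c d) (hT : ValidEdgeSet P T) (hac : s(a, c) ∈ T) :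
    s(b, d) ∉ T := by
  intro hbd
  obtain ⟨p, h1, h2, h3, h4⟩ := h.crossing_mem
  have := (hT.2.2.1 _ hac _ hbd h.diag_ne_diag p h1 h2).1
  rw [Sym2.mem_iff] at this
  tauto

lemma mem_of_mem_halfEdges {T' : Set (Sym2 Pt)} (h : FlipQuad P a b c d)
    (hsub : halfEdges a b c d ⊆ T)
    (hT' : T' = (T \ {s(a, c)}) ∪ {s(b, d)}) : halfEdges b c d a ⊆ T' := by
  have hne := h.ne_diag
  rw [hT']
  intro e he
  rw [mem_halfEdges] at he
  have hmem : ∀ e, e ∈ halfEdges a b c d → e ≠ s(a, c) → e ∈ (T \ {s(a, c)}) ∪ {s(b, d)} :=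
    fun e he hne => Or.inl ⟨hsub he, hne⟩
  rcases he with rfl | rfl | rfl | rfl | rfl
  · exact hmem _ (by simp [halfEdges]) (by rw [Ne, Sym2.eq_iff]; tauto)
  · exact hmem _ (by simp [halfEdges]) (by rw [Ne, Sym2.eq_iff]; tauto)
  · exact hmem _ (by simp [halfEdges]) (by rw [Ne, Sym2.eq_iff]; tauto)
  · exact hmem _ (by simp [halfEdges]) (by rw [Ne, Sym2.eq_iff]; tauto)
  · exact Or.inr rfl

/-- On the new diagonal, the only points of the two halves' vertices are its endpoints. -/
lemma ne_of_mem_diag (h : FlipQuad P a b c d) {p : Pt} (hp : p ∈ segOf s(b, d)) :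
    p ≠ a ∧ p ≠ c := by
  obtain ⟨x, y, hx, hy, hxy, hp⟩ := mem_segOf.1 hp
  have h1 := h.rotate.area_ne
  have h2 := h.rotate.area_right
  have hz : signedArea b d p = 0 := by
    rw [← hp, signedArea_comb_two _ _ _ _ hxy]
    simp
  constructor
  · rintro rfl; exact h2 hz
  · rintro rfl
    rw [signedArea_swap_right, hz, neg_zero] at h1
    exact h1 rfl

/-- An edge of a half other than the cut meets the other diagonal only in a common endpoint. -/
lemma mem_of_side {a b d x : Pt} (ha : signedArea a b d ≠ 0) (h1 : x ∈ segOf s(a, b))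
    (h2 : x ∈ segOf s(b, d)) : x = b := by
  obtain ⟨u, v, hu, hv, huv, rfl⟩ := mem_segOf.1 h1
  obtain ⟨u', v', hu', hv', huv', heq⟩ := mem_segOf.1 h2
  have := congrArg (signedArea a b) heq
  rw [signedArea_comb_two _ _ _ _ huv', signedArea_comb_two _ _ _ _ huv] at this
  simp only [signedArea_left, signedArea_right] at this
  have hv0 : v' * signedArea a b d = 0 := by linarith
  have hv0 := (mul_eq_zero.1 hv0).resolve_right ha
  rw [← heq, hv0, show u' = 1 by linarith]
  simp

/-- Flipping the diagonal of a flip quadrilateral preserves validity of the edge set. -/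
lemma valid_flip (h : FlipQuad P a b c d) (hT : ValidEdgeSet P T)
    (hsub : halfEdges a b c d ⊆ T) : ValidEdgeSet P ((T \ {s(a, c)}) ∪ {s(b, d)}) := by
  have hne := h.ne_diag
  have hl := h.isTriangleOf_left hsub
  have hr := h.isTriangleOf_right hsub
  have hbP : b ∈ P := hT.2.1 _ hl.1 _ (by simp)
  have hdP : d ∈ P := hT.2.1 _ hr.2.1 _ (by simp)
  have hhull : ∀ p ∈ segOf s(b, d),
      p ∈ convexHull ℝ ({a, b, c} : Set Pt) ∨ p ∈ convexHull ℝ ({a, c, d} : Set Pt) := by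
    intro p hp
    obtain ⟨s, t, hs0, hs1, ht0, ht1, hst⟩ := h.cross
    obtain ⟨x, y, hx, hy, hxy, rfl⟩ := mem_segOf.1 hp
    exact mem_halves hs0 hs1 ht0 ht1 hst
      (mem_convexHull_triple.2 ⟨x, y, 0, hx, hy, le_rfl, by linarith, by simp⟩)
  have hmeet : ∀ e ∈ T, e ≠ s(a, c) → ∀ x, x ∈ segOf e → x ∈ segOf s(b, d) →
      x ∈ e ∧ x ∈ s(b, d) := by
    intro e he hac x hxe hx
    have hxne := h.ne_of_mem_diag hx
    have hbd : x = b ∨ x = d := by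
      have hx' : x ∈ segOf s(d, b) := by rwa [Sym2.eq_swap]
      have hc := h.area_bcd
      have hd := h.rotate.area_right
      by_cases h1 : EdgeOfTriangle e a b c
      · left
        rcases h1 with rfl | rfl | rfl
        · exact mem_of_side (by rwa [← signedArea_rotate]) hxe hx
        · rw [Sym2.eq_swap] at hxe
          exact mem_of_side (by rwa [signedArea_swap, neg_ne_zero]) hxe hx
        · exact absurd rfl hac
      by_cases h2 : EdgeOfTriangle e a c d
      · right
        rcases h2 with rfl | rfl | rfl
        · exact absurd rfl hac
        · exact mem_of_side (by rwa [signedArea_rotate]) hxe hx'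
        · exact mem_of_side (by rwa [← signedArea_rotate, signedArea_swap_right, neg_ne_zero,
            ← signedArea_rotate, signedArea_rotate, signedArea_rotate]) hxe hx'
      rcases hhull x hx with hm | hm
      · have := eq_vertex_of_mem_seg_of_mem_triangle hT hl he h1 hxe hm
        tauto
      · have := eq_vertex_of_mem_seg_of_mem_triangle hT hr he h2 hxe hm
        tauto
    refine ⟨?_, by rwa [Sym2.mem_iff]⟩
    have hxP : x ∈ P := by rcases hbd with rfl | rfl <;> assumption
    have hopen := hT.2.2.2 e he x hxP
    clear hhull hac
    induction e using Sym2.ind with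
    | _ u v =>
      rw [Sym2.mem_iff]
      by_contra hcon
      push Not at hcon
      exact hopen (mem_openSegment_of_ne_left_right hcon.1.symm hcon.2.symm hxe)
  refine ⟨?_, ?_, ?_, ?_⟩
  · rintro e (⟨he, -⟩ | rfl)
    · exact hT.1 e he
    · simpa using hne.2.2.2.2.2
  · rintro e (⟨he, -⟩ | rfl) x hx
    · exact hT.2.1 e he x hx
    · rcases Sym2.mem_iff.1 hx with rfl | rfl <;> assumption
  · rintro e (⟨he, he'⟩ | rfl) f (⟨hf, hf'⟩ | rfl) hef x hxe hxf
    · exact hT.2.2.1 e he f hf hef x hxe hxf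
    · exact hmeet e he he' x hxe hxf
    · exact (hmeet f hf hf' x hxf hxe).symm
    · exact absurd rfl hef
  · rintro e (⟨he, -⟩ | rfl) p hp
    · exact hT.2.2.2 e he p hp
    · intro hop
      have hseg : p ∈ segOf s(b, d) := openSegment_subset_segment ℝ b d hop
      have hpne := h.ne_of_mem_diag hseg
      obtain ⟨x, y, hx, hy, hxy, hpxy⟩ := mem_openSegOf.1 hop
      have hpbd : p ≠ b ∧ p ≠ d := by
        constructor
        · rintro rfl
          have h0 : y • (d - p) = 0 := by
            obtain rfl : x = 1 - y := by linarith
            rw [← sub_eq_zero] at hpxy; rw [← hpxy]; module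
          rcases smul_eq_zero.1 h0 with h0 | h0
          · linarith
          · exact hne.2.2.2.2.2 (sub_eq_zero.1 h0).symm
        · rintro rfl
          have h0 : x • (b - p) = 0 := by
            obtain rfl : y = 1 - x := by linarith
            rw [← sub_eq_zero] at hpxy; rw [← hpxy]; module
          rcases smul_eq_zero.1 h0 with h0 | h0
          · linarith
          · exact hne.2.2.2.2.2 (sub_eq_zero.1 h0)
      rcases hhull p hseg with hm | hm
      · have := h.empty_left p hp hm
        tauto
      · have := h.empty_right p hp hm
        tauto

/-- A triangle destroyed in going back over a flip contains the flipped edge's neighbours. -/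
lemma shareTriangle_of_flip {T' : Set (Sym2 Pt)} (h : FlipQuad P a b c d)
    (hT : ValidEdgeSet P T) (hsub : halfEdges a b c d ⊆ T)
    (hT' : T' = (T \ {s(a, c)}) ∪ {s(b, d)}) {e f : Sym2 Pt} (he : e ∈ T)
    (hs : ShareTriangle P T' e f) (hn : ¬ ShareTriangle P T s(a, c) e) :
    ShareTriangle P T e f := by
  have hbd : s(b, d) ∉ T := h.diag_notMem hT (hsub (by simp [halfEdges]))
  obtain ⟨u, v, w, ht, h1, h2⟩ := hs
  by_cases hφ : EdgeOfTriangle s(b, d) u v w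
  · exfalso
    have hshare : ShareTriangle P T' s(b, d) e := ⟨u, v, w, ht, hφ, h1⟩
    rw [h.rotate.shareTriangle_iff (hT' ▸ h.valid_flip hT hsub)
      (h.mem_of_mem_halfEdges hsub hT'), mem_halfEdges] at hshare
    rw [h.shareTriangle_iff hT hsub, mem_halfEdges] at hn
    rw [Sym2.eq_swap (a := d) (b := a), Sym2.eq_swap (a := b) (b := a)] at hshare
    have : e ≠ s(b, d) := fun h => hbd (h ▸ he)
    tauto
  · have hback : ∀ g ∈ T', EdgeOfTriangle g u v w → g ∈ T := by
      intro g hg hguvw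
      rw [hT'] at hg
      rcases hg with hg | rfl
      · exact hg.1
      · exact absurd hguvw hφ
    exact ⟨u, v, w, ⟨hback _ ht.1 (Or.inl rfl), hback _ ht.2.1 (Or.inr (Or.inl rfl)),
      hback _ ht.2.2.1 (Or.inr (Or.inr rfl)), ht.2.2.2⟩, h1, h2⟩

end FlipQuad

lemma IsFlipQuad.flipQuad {P : Set Pt} {T : Set (Sym2 Pt)} {a b c d : Pt}
    (hT : ValidEdgeSet P T) (h : IsFlipQuad P T a b c d) : FlipQuad P a b c d := by
  obtain ⟨hl, hr, hbd, hconv⟩ := h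
  have hA := hl.signedArea_ne_zero
  have hB := hr.signedArea_ne_zero
  obtain ⟨x, y, z, hsum, hd⟩ := exists_barycentric hA d
  have hy : y < 0 := by
    by_contra hcon
    rcases (not_lt.1 hcon).eq_or_lt with hy | hy
    · apply hB
      rw [hd, signedArea_comb _ _ _ _ _ hsum, ← hy]
      simp
    · exact hbd (apex_eq_of_same_side hT hl.swap_right hr (x := x) (y := z) (z := y)
        (by linarith) hy (by rw [hd]; abel))
  have hab : a ≠ b := by rintro rfl; simp at hA
  have hbc : b ≠ c := by rintro rfl; simp at hA
  have hac : a ≠ c := by rintro rfl; simp at hB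
  have hcd : c ≠ d := by rintro rfl; simp at hB
  have had : a ≠ d := by rintro rfl; simp at hB
  have hx : 0 < x := by
    by_contra hcon
    have hz : 0 < z := by linarith
    refine hconv c (by simp) (convexHull_mono (s := {a, b, d}) ?_ (mem_convexHull_triple.2
      ⟨-x / z, -y / z, 1 / z, div_nonneg (by linarith) hz.le, div_nonneg (by linarith) hz.le,
        by positivity, by field_simp; linarith, ?_⟩))
    · rintro p (rfl | rfl | rfl) <;> simp [hab, hbc, hac, had, hcd.symm]
    · rw [hd]
      match_scalars <;> field_simp <;> ring
  have hz : 0 < z := by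
    by_contra hcon
    refine hconv a (by simp) (convexHull_mono (s := {c, b, d}) ?_ (mem_convexHull_triple.2
      ⟨-z / x, -y / x, 1 / x, div_nonneg (by linarith) hx.le, div_nonneg (by linarith) hx.le,
        by positivity, by field_simp; linarith, ?_⟩))
    · rintro p (rfl | rfl | rfl) <;> simp [hab.symm, hac.symm, had.symm]
    · rw [hd]
      match_scalars <;> field_simp <;> ring
  have hy1 : 0 < 1 - y := by linarith
  refine ⟨hA, ⟨x / (1 - y), -y / (1 - y), by positivity, ?_, div_pos (by linarith) hy1, ?_, ?_⟩,
    hl.2.2.2.2, hr.2.2.2.2⟩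
  · rw [div_lt_one hy1]; linarith
  · rw [div_lt_one hy1]; linarith
  · obtain rfl : z = 1 - x - y := by linarith
    rw [hd]
    match_scalars <;> field_simp <;> ring

/-! ### Runs of flips -/

/-- The flips with quadrilaterals `a k`, `b k`, `c k`, `d k`, for `k ∈ R`, performed in increasing
order of `k`: `S k` is the edge set before step `k`, and nothing happens at steps outside `R`.
On `R`, the relation `A` is the arc relation of the flip DAG, expressed by the quadrilaterals. -/
structure FlipRun (P : Set Pt) (a b c d : ℕ → Pt) (A : ℕ → ℕ → Prop) (R : Finset ℕ)
    (S : ℕ → Set (Sym2 Pt)) : Prop where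
  quad : ∀ k ∈ R, FlipQuad P (a k) (b k) (c k) (d k)
  valid_zero : ValidEdgeSet P (S 0)
  sub : ∀ k ∈ R, halfEdges (a k) (b k) (c k) (d k) ⊆ S k
  step : ∀ k ∈ R, S (k + 1) = (S k \ {s(a k, c k)}) ∪ {s(b k, d k)}
  idle : ∀ k ∉ R, S (k + 1) = S k
  arc : ∀ i ∈ R, ∀ j ∈ R, A i j ↔ i < j ∧ s(b i, d i) ∈ halfEdges (a j) (b j) (c j) (d j) ∧
    ∀ p ∈ R, i < p → p < j → s(a p, c p) ≠ s(b i, d i)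

namespace FlipRun

variable {P : Set Pt} {a b c d : ℕ → Pt} {A : ℕ → ℕ → Prop} {R : Finset ℕ}
  {S : ℕ → Set (Sym2 Pt)}

lemma valid (h : FlipRun P a b c d A R S) (k : ℕ) : ValidEdgeSet P (S k) := by
  induction k with
  | zero => exact h.valid_zero
  | succ k ih =>
    by_cases hk : k ∈ R
    · rw [h.step k hk]
      exact (h.quad k hk).valid_flip ih (h.sub k hk)
    · rwa [h.idle k hk]

lemma diag_mem_halfEdges (a b c d : Pt) : s(a, c) ∈ halfEdges a b c d := by
  simp [halfEdges]

lemma diag_mem (h : FlipRun P a b c d A R S) {k : ℕ} (hk : k ∈ R) : s(a k, c k) ∈ S k :=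
  h.sub k hk (diag_mem_halfEdges _ _ _ _)

lemma newDiag_notMem (h : FlipRun P a b c d A R S) {k : ℕ} (hk : k ∈ R) : s(b k, d k) ∉ S k :=
  (h.quad k hk).diag_notMem (h.valid k) (h.diag_mem hk)

lemma diag_notMem_succ (h : FlipRun P a b c d A R S) {k : ℕ} (hk : k ∈ R) :
    s(a k, c k) ∉ S (k + 1) := by
  rw [h.step k hk]
  rintro (⟨-, h1⟩ | h1)
  · exact h1 rfl
  · exact (h.quad k hk).diag_ne_diag h1

lemma shareTriangle_iff (h : FlipRun P a b c d A R S) {k : ℕ} (hk : k ∈ R) {e : Sym2 Pt} :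
    ShareTriangle P (S k) s(a k, c k) e ↔ e ∈ halfEdges (a k) (b k) (c k) (d k) :=
  (h.quad k hk).shareTriangle_iff (h.valid k) (h.sub k hk)

lemma flip_comm {α : Type*} {X : Set α} {e e' f f' : α} (h1 : f' ≠ e) (h2 : e' ≠ f) :
    (((X \ {e}) ∪ {e'}) \ {f}) ∪ {f'} = (((X \ {f}) ∪ {f'}) \ {e}) ∪ {e'} := by
  ext x
  simp only [Set.mem_union, Set.mem_sdiff, Set.mem_singleton_iff]
  grind

lemma flip_flip_back {α : Type*} {X : Set α} {e e' : α} (h1 : e ∈ X) (h2 : e' ∉ X) :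
    (((X \ {e}) ∪ {e'}) \ {e'}) ∪ {e} = X := by
  ext x
  simp only [Set.mem_union, Set.mem_sdiff, Set.mem_singleton_iff]
  grind

/-- No flip before a source `s` touches the quadrilateral of `s`. -/
lemma untouched_before_source (h : FlipRun P a b c d A R S) {s : ℕ} (hs : s ∈ R)
    (hsrc : ∀ j ∈ R, ¬ A j s) {k : ℕ} (hk : k ≤ s) :
    halfEdges (a s) (b s) (c s) (d s) ⊆ S k ∧
      ∀ i ∈ R, k ≤ i → i < s → s(b i, d i) ∉ halfEdges (a s) (b s) (c s) (d s) ∧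
        s(a i, c i) ∉ halfEdges (a s) (b s) (c s) (d s) := by
  induction hk using Nat.decreasingInduction with
  | self => exact ⟨h.sub s hs, fun i _ h1 h2 => absurd h1 (by omega)⟩
  | of_succ k hk ih =>
    obtain ⟨ih1, ih2⟩ := ih
    by_cases hkR : k ∈ R
    · have hnew : s(b k, d k) ∉ halfEdges (a s) (b s) (c s) (d s) := fun hmem =>
        hsrc k hkR ((h.arc k hkR s hs).2 ⟨hk, hmem, fun p hp h1 h2 heq =>
          (ih2 p hp h1 h2).2 (heq ▸ hmem)⟩)
      have hold : s(a k, c k) ∉ halfEdges (a s) (b s) (c s) (d s) := fun hmem =>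
        h.diag_notMem_succ hkR (ih1 hmem)
      refine ⟨fun e he => ?_, fun i hi h1 h2 => ?_⟩
      · have := ih1 he
        rw [h.step k hkR] at this
        rcases this with this | this
        · exact this.1
        · exact absurd (this ▸ he) hnew
      · rcases h1.eq_or_lt with rfl | h1
        · exact ⟨hnew, hold⟩
        · exact ih2 i hi h1 h2
    · refine ⟨h.idle k hkR ▸ ih1, fun i hi h1 h2 => ?_⟩
      rcases h1.eq_or_lt with rfl | h1
      · exact absurd hi hkR
      · exact ih2 i hi h1 h2

/-- A source can be performed first. -/
lemma erase_source (h : FlipRun P a b c d A R S) {s : ℕ} (hs : s ∈ R)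
    (hsrc : ∀ j ∈ R, ¬ A j s) :
    FlipRun P a b c d A (R.erase s)
      (fun k => if k ≤ s then (S k \ {s(a s, c s)}) ∪ {s(b s, d s)} else S k) := by
  have hpre := fun {k : ℕ} (hk : k ≤ s) => (h.untouched_before_source hs hsrc hk).1
  have hout := (h.untouched_before_source hs hsrc (Nat.zero_le s)).2
  refine ⟨fun k hk => h.quad k (Finset.mem_of_mem_erase hk), ?_, ?_, ?_, ?_, ?_⟩
  · simp only [Nat.zero_le, if_true]
    exact (h.quad s hs).valid_flip h.valid_zero (hpre (Nat.zero_le s))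
  · intro k hk
    obtain ⟨hks, hkR⟩ := Finset.mem_erase.1 hk
    split_ifs with hle
    · have hlt : k < s := lt_of_le_of_ne hle hks
      intro e he
      refine Or.inl ⟨h.sub k hkR he, ?_⟩
      rintro rfl
      have hsh := ((h.shareTriangle_iff hkR).2 he).symm
      rw [(h.quad s hs).shareTriangle_iff (h.valid k) (hpre hle)] at hsh
      exact (hout k hkR (Nat.zero_le k) hlt).2 hsh
    · exact h.sub k hkR
  · intro k hk
    obtain ⟨hks, hkR⟩ := Finset.mem_erase.1 hk
    by_cases hle : k ≤ s
    · have hlt : k < s := lt_of_le_of_ne hle hks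
      rw [if_pos (Nat.succ_le_of_lt hlt), if_pos hle, h.step k hkR]
      refine flip_comm ?_ ?_
      · intro heq
        have := (h.quad s hs).diag_notMem (h.valid k) (hpre hle (diag_mem_halfEdges _ _ _ _))
        exact this (heq ▸ h.diag_mem hkR)
      · intro heq
        exact (hout k hkR (Nat.zero_le k) hlt).1 (heq ▸ diag_mem_halfEdges _ _ _ _)
    · rw [if_neg (by omega), if_neg hle, h.step k hkR]
  · intro k hk
    rcases eq_or_ne k s with rfl | hks
    · rw [if_neg (by omega), if_pos le_rfl, h.step k hs]
    · have hkR : k ∉ R := fun hkR => hk (Finset.mem_erase.2 ⟨hks, hkR⟩)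
      by_cases hle : k ≤ s
      · rw [if_pos (by omega), if_pos hle, h.idle k hkR]
      · rw [if_neg (by omega), if_neg hle, h.idle k hkR]
  · intro i hi j hj
    obtain ⟨his, hiR⟩ := Finset.mem_erase.1 hi
    obtain ⟨hjs, hjR⟩ := Finset.mem_erase.1 hj
    rw [h.arc i hiR j hjR]
    refine and_congr_right fun hij => and_congr_right fun hmem =>
      ⟨fun H p hp => H p (Finset.mem_of_mem_erase hp), fun H p hp h1 h2 => ?_⟩
    rcases eq_or_ne p s with rfl | hps
    · intro heq
      exact (hout i hiR (Nat.zero_le i) h1).1 (heq ▸ diag_mem_halfEdges _ _ _ _)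
    · exact H p (Finset.mem_erase.2 ⟨hps, hp⟩) h1 h2

/-- After a sink `k`, no flip touches the flipped quadrilateral of `k`. -/
lemma untouched_after_sink (h : FlipRun P a b c d A R S) {k : ℕ} (hk : k ∈ R)
    (hsink : ∀ j ∈ R, ¬ A k j) {m : ℕ} (hm : k + 1 ≤ m) :
    halfEdges (b k) (c k) (d k) (a k) ⊆ S m ∧
      ∀ j ∈ R, k < j → j < m → s(b k, d k) ∉ halfEdges (a j) (b j) (c j) (d j) := by
  induction m, hm using Nat.le_induction with
  | base =>
    exact ⟨(h.quad k hk).mem_of_mem_halfEdges (h.sub k hk) (h.step k hk),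
      fun j _ h1 h2 => absurd h1 (by omega)⟩
  | succ m hm ih =>
    obtain ⟨ih1, ih2⟩ := ih
    by_cases hmR : m ∈ R
    · have hnew : s(b k, d k) ∉ halfEdges (a m) (b m) (c m) (d m) := fun hmem =>
        hsink m hmR ((h.arc k hk m hmR).2 ⟨hm, hmem, fun p hp h1 h2 heq =>
          ih2 p hp h1 h2 (heq ▸ diag_mem_halfEdges _ _ _ _)⟩)
      refine ⟨fun e he => ?_, fun j hj h1 h2 => ?_⟩
      · rw [h.step m hmR]
        refine Or.inl ⟨ih1 he, ?_⟩
        rintro rfl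
        have hsh := (((h.quad k hk).rotate.shareTriangle_iff (h.valid m) ih1).2 he).symm
        exact hnew ((h.shareTriangle_iff hmR).1 hsh)
      · rcases (Nat.lt_succ_iff.1 h2).eq_or_lt with rfl | h2
        · exact hnew
        · exact ih2 j hj h1 h2
    · refine ⟨(h.idle m hmR).symm ▸ ih1, fun j hj h1 h2 => ?_⟩
      rcases (Nat.lt_succ_iff.1 h2).eq_or_lt with rfl | h2
      · exact absurd hj hmR
      · exact ih2 j hj h1 h2

/-- A sink can be omitted. -/
lemma erase_sink (h : FlipRun P a b c d A R S) {k : ℕ} (hk : k ∈ R)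
    (hsink : ∀ j ∈ R, ¬ A k j) :
    FlipRun P a b c d A (R.erase k)
      (fun m => if m ≤ k then S m else (S m \ {s(b k, d k)}) ∪ {s(a k, c k)}) := by
  have hpost := fun {m : ℕ} (hm : k < m) => (h.untouched_after_sink hk hsink hm).1
  have hout : ∀ j ∈ R, k < j → s(b k, d k) ∉ halfEdges (a j) (b j) (c j) (d j) :=
    fun j hj hkj => (h.untouched_after_sink hk hsink (m := j + 1) (by omega)).2 j hj hkj
      (Nat.lt_succ_self j)
  have hnewmem : ∀ m, k < m → s(b k, d k) ∈ S m := fun m hm =>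
    hpost hm (diag_mem_halfEdges _ _ _ _)
  have holdnot : ∀ m, k < m → s(a k, c k) ∉ S m := fun m hm hmem =>
    (h.quad k hk).diag_notMem (h.valid m) hmem (hnewmem m hm)
  refine ⟨fun k hk => h.quad k (Finset.mem_of_mem_erase hk), ?_, ?_, ?_, ?_, ?_⟩
  · simpa using h.valid_zero
  · intro j hj
    obtain ⟨hjk, hjR⟩ := Finset.mem_erase.1 hj
    split_ifs with hle
    · exact h.sub j hjR
    · intro e he
      refine Or.inl ⟨h.sub j hjR he, ?_⟩
      rintro rfl
      exact hout j hjR (by omega) he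
  · intro j hj
    obtain ⟨hjk, hjR⟩ := Finset.mem_erase.1 hj
    by_cases hle : j ≤ k
    · rw [if_pos (by omega), if_pos hle, h.step j hjR]
    · have hlt : k < j := by omega
      rw [if_neg (by omega), if_neg hle, h.step j hjR]
      refine flip_comm ?_ ?_
      · intro heq
        exact holdnot j hlt (heq ▸ h.diag_mem hjR)
      · intro heq
        exact h.newDiag_notMem hjR (heq ▸ hnewmem j hlt)
  · intro m hm
    rcases eq_or_ne m k with rfl | hmk
    · rw [if_neg (by omega), if_pos le_rfl, h.step m hk]
      exact flip_flip_back (h.diag_mem hk) (h.newDiag_notMem hk)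
    · have hmR : m ∉ R := fun hmR => hm (Finset.mem_erase.2 ⟨hmk, hmR⟩)
      by_cases hle : m ≤ k
      · rw [if_pos (by omega), if_pos hle, h.idle m hmR]
      · rw [if_neg (by omega), if_neg hle, h.idle m hmR]
  · intro i hi j hj
    obtain ⟨hik, hiR⟩ := Finset.mem_erase.1 hi
    obtain ⟨hjk, hjR⟩ := Finset.mem_erase.1 hj
    rw [h.arc i hiR j hjR]
    refine and_congr_right fun hij => and_congr_right fun hmem =>
      ⟨fun H p hp => H p (Finset.mem_of_mem_erase hp), fun H p hp h1 h2 => ?_⟩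
    rcases eq_or_ne p k with rfl | hpk
    · intro heq
      exact holdnot j h2 (h.sub j hjR (heq ▸ hmem))
    · exact H p (Finset.mem_erase.2 ⟨hpk, hp⟩) h1 h2

/-- Performing the flips of `L`, each a source at its time, leaves a run of the other flips. -/
lemma eliminate (L : List ℕ) (h : FlipRun P a b c d A R S) (hnd : L.Nodup)
    (hmem : ∀ i ∈ L, i ∈ R)
    (hsrc : ∀ t, ∀ ht : t < L.length, ∀ j ∈ R, A j (L.get ⟨t, ht⟩) → j ∈ L.take t) :
    ∃ S', FlipRun P a b c d A (R \ L.toFinset) S' ∧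
      S' 0 = applyFlips (S 0) (L.map fun k => (s(a k, c k), s(b k, d k))) := by
  induction L generalizing R S with
  | nil => exact ⟨S, by simpa using h, rfl⟩
  | cons l L ih =>
    have hl : ∀ j ∈ R, ¬ A j l := fun j hj hA => by
      simpa using hsrc 0 (by simp) j hj hA
    obtain ⟨hlL, hnd⟩ := List.nodup_cons.1 hnd
    obtain ⟨S', hS', h0⟩ := ih (h.erase_source (hmem l (by simp)) hl) hnd
      (fun i hi => Finset.mem_erase.2 ⟨fun he => hlL (he ▸ hi), hmem i (by simp [hi])⟩)
      (fun t ht j hj hA => by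
        obtain ⟨hjl, hjR⟩ := Finset.mem_erase.1 hj
        have := hsrc (t + 1) (by simpa using ht) j hjR hA
        simpa [hjl] using this)
    refine ⟨S', ?_, ?_⟩
    · convert hS' using 1
      ext x
      simp only [Finset.mem_sdiff, List.mem_toFinset, List.mem_cons, Finset.mem_erase]
      tauto
    · rw [h0]
      simp [applyFlips]

/-- If the edge flipped by `h` is present at the start and `h` is not a source, then some earlier
flip flips an edge sharing a triangle with it at the start. -/
lemma exists_earlier_neighbour (H : FlipRun P a b c d A R S) {h : ℕ} (hh : h ∈ R)
    (he : s(a h, c h) ∈ S 0) (hns : ∃ j ∈ R, A j h) :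
    ∃ q ∈ R, q < h ∧ ShareTriangle P (S 0) s(a q, c q) s(a h, c h) := by
  classical
  have hself : ∀ k ∈ R, ShareTriangle P (S k) s(a k, c k) s(a k, c k) := fun k hk =>
    (H.shareTriangle_iff hk).2 (diag_mem_halfEdges _ _ _ _)
  have hex : ∃ q, q ∈ R ∧ ShareTriangle P (S q) s(a q, c q) s(a h, c h) := ⟨h, hh, hself h hh⟩
  obtain ⟨q, ⟨hqR, hq⟩, hmin⟩ : ∃ q, (q ∈ R ∧ ShareTriangle P (S q) s(a q, c q) s(a h, c h)) ∧
      ∀ k < q, ¬ (k ∈ R ∧ ShareTriangle P (S k) s(a k, c k) s(a h, c h)) :=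
    ⟨Nat.find hex, Nat.find_spec hex, fun k hk => Nat.find_min hex hk⟩
  have hstay : ∀ k ≤ q, s(a h, c h) ∈ S k := by
    intro k
    induction k with
    | zero => exact fun _ => he
    | succ k ih =>
      intro hk
      have hmem := ih (by omega)
      by_cases hkR : k ∈ R
      · rw [H.step k hkR]
        refine Or.inl ⟨hmem, fun heq => hmin k hk ⟨hkR, ?_⟩⟩
        rw [Set.mem_singleton_iff.1 heq]
        exact hself k hkR
      · rwa [H.idle k hkR]
  have hback : ∀ e, ShareTriangle P (S q) s(a h, c h) e → ∀ k ≤ q,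
      ShareTriangle P (S k) s(a h, c h) e := by
    intro e hes k hk
    induction hk using Nat.decreasingInduction with
    | self => exact hes
    | of_succ k hk ih =>
      by_cases hkR : k ∈ R
      · exact (H.quad k hkR).shareTriangle_of_flip (H.valid k) (H.sub k hkR) (H.step k hkR)
          (hstay k hk.le) ih (fun hsh => hmin k hk ⟨hkR, hsh⟩)
      · rwa [H.idle k hkR] at ih
  have hqh : q ≤ h := by
    by_contra hcon
    exact hmin h (by omega) ⟨hh, hself h hh⟩
  rcases hqh.eq_or_lt with rfl | hlt
  · obtain ⟨j, hjR, hj⟩ := hns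
    obtain ⟨hjq, hjm, -⟩ := (H.arc j hjR q hqR).1 hj
    exact absurd (hback _ ((H.shareTriangle_iff hqR).2 hjm) j hjq.le).symm.left_mem
      (H.newDiag_notMem hjR)
  · exact ⟨q, hqR, hlt, (hback _ hq.symm 0 (Nat.zero_le q)).symm⟩

/-- If every flip other than `h` has an outgoing arc, then every flip has a path to `h`. -/
lemma exists_path (H : FlipRun P a b c d A R S) {h : ℕ}
    (hout : ∀ k ∈ R, k ≠ h → ∃ j ∈ R, A k j) {k : ℕ} (hk : k ∈ R) :
    ∃ l : List ℕ, (k :: l).IsChain A ∧ (k :: l).getLast? = some h ∧ ∀ x ∈ l, x ∈ R := by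
  obtain ⟨N, hN⟩ : ∃ N, ∀ x ∈ R, x ≤ N := ⟨R.sup id, fun x hx => Finset.le_sup (f := id) hx⟩
  induction hn : N - k using Nat.strong_induction_on generalizing k with
  | _ n ih =>
    by_cases hkh : k = h
    · exact ⟨[], by simp, by simp [hkh], by simp⟩
    · obtain ⟨j, hj, hA⟩ := hout k hk hkh
      have hlt := ((H.arc k hk j hj).1 hA).1
      have := hN j hj
      obtain ⟨l, h1, h2, h3⟩ := ih (N - j) (by omega) hj rfl
      exact ⟨j :: l, by simp [h1, hA], by simpa using h2, List.forall_mem_cons.2 ⟨hj, h3⟩⟩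

/-- The backbone lemma for runs. -/
lemma exists_backbone (H : FlipRun P a b c d A R S) {h : ℕ} (hh : h ∈ R)
    (he : s(a h, c h) ∈ S 0) :
    ∃ s ∈ R, (∀ j ∈ R, ¬ A j s) ∧ ∃ V B : List ℕ,
      V ≠ [] ∧ V.head? = some s ∧ V.getLast? = some h ∧ (∀ i ∈ V, i ∈ B) ∧
      V.IsChain (fun vi vj => (∃ Bi : List ℕ, Bi.IsChain A ∧ Bi.head? = some vi ∧
        Bi.getLast? = some vj ∧ Bi <:+: B) ∧
        ShareTriangle P (S 0) s(a vi, c vi) s(a vj, c vj)) ∧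
      (∀ i ∈ V, s(a i, c i) ∈ S 0) ∧
      (∀ i ∈ B, i ∈ R) ∧ B.head? = some s ∧ B.getLast? = some h ∧ B.IsChain A ∧
      V.length ≤ B.length := by
  induction hn : R.card generalizing R S h with
  | zero => simp [Finset.card_eq_zero.1 hn] at hh
  | succ n ih =>
    by_cases hsink : ∃ k ∈ R, k ≠ h ∧ ∀ j ∈ R, ¬ A k j
    · obtain ⟨k, hkR, hkh, hk⟩ := hsink
      obtain ⟨s, hs, hsrc, V, B, h1, h2, h3, h4, h5, h6, h7, h8⟩ :=
        ih (H.erase_sink hkR hk) (h := h) (Finset.mem_erase.2 ⟨hkh.symm, hh⟩) (by simpa using he)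
          (by rw [Finset.card_erase_of_mem hkR, hn]; rfl)
      simp only [Nat.zero_le, if_true] at h5 h6
      have hsR := Finset.mem_of_mem_erase hs
      refine ⟨s, hsR, fun j hj => ?_, V, B, h1, h2, h3, h4, h5, h6,
        fun i hi => Finset.mem_of_mem_erase (h7 i hi), h8⟩
      rcases eq_or_ne j k with rfl | hjk
      · exact hk s hsR
      · exact hsrc j (Finset.mem_erase.2 ⟨hjk, hj⟩)
    · push Not at hsink
      by_cases hns : ∃ j ∈ R, A j h
      · obtain ⟨q, hqR, hqh, hq⟩ := H.exists_earlier_neighbour hh he hns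
        obtain ⟨l, hl1, hl2, hl3⟩ := H.exists_path hsink hqR
        have hmax : ∀ j ∈ R, ¬ A h j := by
          intro j hj hA
          have hhj := ((H.arc h hh j hj).1 hA).1
          obtain ⟨m, hm, hmmax⟩ := R.exists_max_image id ⟨h, hh⟩
          have hmj := hmmax j hj
          simp only [id] at hmj
          obtain ⟨x, hx, hmx⟩ := hsink m hm (by omega)
          have := ((H.arc m hm x hx).1 hmx).1
          have := hmmax x hx
          simp only [id] at this
          omega
        obtain ⟨s, hs, hsrc, V, B, h1, h2, h3, h4, h5, h6, h7, h8, h9, h10, h11⟩ :=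
          ih (H.erase_sink hh hmax) (h := q) (Finset.mem_erase.2 ⟨hqh.ne, hqR⟩)
            (by simpa using hq.left_mem) (by rw [Finset.card_erase_of_mem hh, hn]; rfl)
        simp only [Nat.zero_le, if_true] at h5 h6
        have hsR := Finset.mem_of_mem_erase hs
        have hl0 : l ≠ [] := by
          rintro rfl
          simp at hl2
          omega
        obtain ⟨B', rfl⟩ : ∃ B', B = B' ++ [q] := List.getLast?_eq_some_iff.1 h9
        have hpath : B' ++ [q] ++ l = B' ++ (q :: l) := by simp
        have hlast : (B' ++ [q] ++ l).getLast? = some h := by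
          rw [hpath, List.getLast?_append, hl2]; rfl
        refine ⟨s, hsR, fun j hj => ?_, V ++ [h], B' ++ [q] ++ l, by simp, ?_, by simp, ?_, ?_, ?_,
          ?_, ?_, hlast, ?_, ?_⟩
        · rcases eq_or_ne j h with rfl | hjh
          · exact hmax s hsR
          · exact hsrc j (Finset.mem_erase.2 ⟨hjh, hj⟩)
        · rw [List.head?_append, h2]; rfl
        · intro i hi
          rcases List.mem_append.1 hi with hi | hi
          · exact List.mem_append_left _ (h4 i hi)
          · rw [List.mem_singleton.1 hi]
            exact List.mem_of_getLast? hlast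
        · rw [List.isChain_append]
          refine ⟨h5.imp ?_, by simp, ?_⟩
          · rintro x y ⟨⟨Bi, b1, b2, b3, b4⟩, hsh⟩
            exact ⟨⟨Bi, b1, b2, b3, b4.trans (List.prefix_append _ _).isInfix⟩, hsh⟩
          · intro x hx y hy
            rw [h3] at hx
            obtain rfl : q = x := by simpa using hx
            obtain rfl : h = y := by simpa using hy
            exact ⟨⟨q :: l, hl1, by simp, hl2, hpath ▸ (List.suffix_append _ _).isInfix⟩, hq⟩
        · intro i hi
          rcases List.mem_append.1 hi with hi | hi
          · exact h6 i hi
          · rw [List.mem_singleton.1 hi]; exact he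
        · intro i hi
          rcases List.mem_append.1 hi with hi | hi
          · exact Finset.mem_of_mem_erase (h7 i hi)
          · exact hl3 i hi
        · rw [List.head?_append, h8]; rfl
        · rw [hpath, List.isChain_append]
          rw [List.isChain_append] at h10
          refine ⟨h10.1, hl1, fun x hx y hy => h10.2.2 x hx y ?_⟩
          simpa using hy
        · have := List.length_pos_iff.2 hl0
          simp only [List.length_append, List.length_singleton] at h11 ⊢
          omega
      · push Not at hns
        exact ⟨h, hh, hns, [h], [h], by simp [hh, he]⟩

end FlipRun

/-! ### The run of a valid flip sequence -/

lemma ValidSeq.flipsTo_take {P : Set Pt} {F : List FlipData} {T T' : Set (Sym2 Pt)}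
    (hF : ValidSeq P T F T') {k : ℕ} (hk : k < F.length) :
    FlipsTo P (applyFlips T (F.take k)) (applyFlips T (F.take (k + 1))) F[k] := by
  induction F generalizing T k with
  | nil => simp at hk
  | cons f F ih =>
    obtain ⟨T₁, h1, h2⟩ := hF
    have hT₁ : T₁ = (T \ {f.1}) ∪ {f.2} := by
      obtain ⟨-, -, a, b, c, d, -, -, -, h⟩ := h1
      exact h
    cases k with
    | zero => simpa [applyFlips, ← hT₁] using h1
    | succ k =>
      have := ih h2 (k := k) (by simpa using hk)
      simpa [applyFlips, ← hT₁] using this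

lemma IsFlipQuad.halfEdges_subset {P : Set Pt} {T : Set (Sym2 Pt)} {a b c d : Pt}
    (h : IsFlipQuad P T a b c d) : halfEdges a b c d ⊆ T := by
  intro e he
  rcases mem_halfEdges.1 he with rfl | rfl | rfl | rfl | rfl
  exacts [h.1.1, h.1.2.1, h.2.1.2.1, h.2.1.2.2.1, h.1.2.2.1]

/-- A nonempty valid flip sequence gives a run whose relation is the arc relation. -/
lemma ValidSeq.exists_flipRun {P : Set Pt} {F : List FlipData} {T T' : Set (Sym2 Pt)}
    (hF : ValidSeq P T F T') (hpos : 0 < F.length) :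
    ∃ a b c d : ℕ → Pt, (∀ k, ∀ hk : k < F.length, F[k] = (s(a k, c k), s(b k, d k))) ∧
      FlipRun P a b c d (Arc P T F) (Finset.range F.length)
        (fun k => applyFlips T (F.take k)) := by
  have hex : ∀ k, ∃ a b c d : Pt, ∀ hk : k < F.length,
      IsFlipQuad P (applyFlips T (F.take k)) a b c d ∧ F[k] = (s(a, c), s(b, d)) ∧
      applyFlips T (F.take (k + 1)) =
        (applyFlips T (F.take k) \ {s(a, c)}) ∪ {s(b, d)} := by
    intro k
    by_cases hk : k < F.length
    · obtain ⟨-, -, a, b, c, d, h1, h2, h3, h4⟩ := hF.flipsTo_take hk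
      rw [h2, h3] at h4
      exact ⟨a, b, c, d, fun _ => ⟨h1, Prod.ext h2 h3, h4⟩⟩
    · exact ⟨0, 0, 0, 0, fun h => absurd h hk⟩
  choose a b c d hq using hex
  have hvalid : ∀ k < F.length, ValidEdgeSet P (applyFlips T (F.take k)) := fun k hk =>
    (hF.flipsTo_take hk).1.1
  have hquad : ∀ k < F.length, FlipQuad P (a k) (b k) (c k) (d k) := fun k hk =>
    (hq k hk).1.flipQuad (hvalid k hk)
  refine ⟨a, b, c, d, fun k hk => (hq k hk).2.1, ⟨?_, ?_, ?_, ?_, ?_, ?_⟩⟩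
  · exact fun k hk => hquad k (Finset.mem_range.1 hk)
  · exact hvalid 0 hpos
  · exact fun k hk => (hq k (Finset.mem_range.1 hk)).1.halfEdges_subset
  · exact fun k hk => (hq k (Finset.mem_range.1 hk)).2.2
  · intro k hk
    rw [Finset.mem_range, not_lt] at hk
    simp only [List.take_of_length_le hk, List.take_of_length_le (hk.trans (Nat.le_succ k))]
  · intro i hi j hj
    rw [Finset.mem_range] at hi hj
    have hiff : (s(b i, d i) = s(a j, c j) ∨
        ShareTriangle P (applyFlips T (F.take j)) s(b i, d i) s(a j, c j)) ↔
        s(b i, d i) ∈ halfEdges (a j) (b j) (c j) (d j) := by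
      rw [← (hquad j hj).shareTriangle_iff (hvalid j hj) (hq j hj).1.halfEdges_subset]
      constructor
      · rintro (heq | hsh)
        · rw [heq, (hquad j hj).shareTriangle_iff (hvalid j hj) (hq j hj).1.halfEdges_subset]
          exact FlipRun.diag_mem_halfEdges _ _ _ _
        · exact hsh.symm
      · exact fun hsh => Or.inr hsh.symm
    rw [← hiff]
    constructor
    · rintro ⟨_, _, hij, h1, h2⟩
      refine ⟨hij, ?_, fun p hp hip hpj => ?_⟩
      · simpa [(hq i hi).2.1, (hq j hj).2.1] using h1
      · have hp := Finset.mem_range.1 hp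
        simpa [(hq i hi).2.1, (hq p hp).2.1] using h2 p hp hip hpj
    · rintro ⟨hij, h1, h2⟩
      refine ⟨hi, hj, hij, ?_, fun p hp hip hpj => ?_⟩
      · simpa [(hq i hi).2.1, (hq j hj).2.1] using h1
      · simpa [(hq i hi).2.1, (hq p hp).2.1] using h2 p (Finset.mem_range.2 hp) hip hpj

lemma filterMap_getElem?_eq_map {α β : Type*} {F : List α} {g : ℕ → β} {f : α → β}
    (hg : ∀ k, ∀ hk : k < F.length, f F[k] = g k) {L : List ℕ} (hL : ∀ i ∈ L, i < F.length) :
    L.filterMap (fun i => (F[i]?).map f) = L.map g := by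
  induction L with
  | nil => rfl
  | cons l L ih =>
    have hl := hL l (by simp)
    rw [List.filterMap_cons_some (b := g l) (by simp [List.getElem?_eq_getElem hl, hg l hl]),
      List.map_cons, ih fun i hi => hL i (by simp [hi])]

/-- **Lemma 3, backbone lemma.** After eliminating source nodes along `L`,
for every remaining node `h` whose underlying edge lives in the current triangulation
there is a remaining source node `s`, a walk `W` in the current triangulation between
`ε(f_h)` and `ε(f_s)`, and a directed path `B` (the backbone) from `s` to `h` in the
remaining DAG, such that the length of `W` is at most that of `B` and every edge of `W`
is the underlying edge of a node on `B`, consecutive such nodes being joined by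
directed subpaths of `B`. -/
theorem backbone_lemma
    (P : Set Pt) (hfin : P.Finite) (hncol : ¬ Collinear ℝ P)
    (Tstart Tend : Set (Sym2 Pt)) (F : List FlipData)
    (hF : ValidSeq P Tstart F Tend)
    (L : List ℕ) (hL : SourceElimOrder P Tstart F L)
    (h : ℕ) (hh : h < F.length) (hhL : h ∉ L)
    (hedge : (F.get ⟨h, hh⟩).1 ∈ applyFlips Tstart (flipsAt F L)) :
    ∃ s : ℕ, s < F.length ∧ s ∉ L ∧
      (∀ j, Arc P Tstart F j s → j ∈ L) ∧
      ∃ (V B : List ℕ),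
        -- (4) the walk W consists of the underlying edges of the nodes of V ⊆ B,
        --     with V beginning at s and ending at h
        V ≠ [] ∧ (∀ i ∈ V, i < F.length) ∧
        V.head? = some s ∧ V.getLast? = some h ∧
        (∀ i ∈ V, i ∈ B) ∧
        V.Chain' (fun vi vj => ∃ Bi : List ℕ, Bi.Chain' (Arc P Tstart F) ∧
          Bi.head? = some vi ∧ Bi.getLast? = some vj ∧ Bi <:+: B) ∧
        -- (1) W is a walk in the current triangulation between ε(f_h) and ε(f_s)
        (∀ e ∈ underlyingEdges F V, e ∈ applyFlips Tstart (flipsAt F L)) ∧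
        (underlyingEdges F V).Chain'
          (fun e f => ShareTriangle P (applyFlips Tstart (flipsAt F L)) e f) ∧
        -- (2) B is a directed path from s to h in the remaining DAG
        B ≠ [] ∧ (∀ i ∈ B, i < F.length ∧ i ∉ L) ∧
        B.head? = some s ∧ B.getLast? = some h ∧
        B.Chain' (Arc P Tstart F) ∧
        -- (3) the length of W is at most that of B
        (underlyingEdges F V).length ≤ B.length := by
  obtain ⟨a, b, c, d, hlab, hrun⟩ := hF.exists_flipRun (by omega)
  obtain ⟨hnd, hlt, hsrc⟩ := hL
  obtain ⟨S, hS, hS0⟩ := hrun.eliminate L hnd (fun i hi => Finset.mem_range.2 (hlt i hi))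
    (fun t ht j _ hA => hsrc t ht j hA)
  have hflips : flipsAt F L = L.map fun k => (s(a k, c k), s(b k, d k)) := by
    have := filterMap_getElem?_eq_map (f := id) hlab hlt
    simpa [flipsAt] using this
  have hunder : ∀ V : List ℕ, (∀ i ∈ V, i < F.length) →
      underlyingEdges F V = V.map fun k => s(a k, c k) := fun V hV =>
    filterMap_getElem?_eq_map (fun k hk => by rw [hlab k hk]) hV
  have hT : applyFlips Tstart (flipsAt F L) = S 0 := by
    rw [hS0, hflips]
    rfl
  rw [hT] at hedge ⊢
  have hmemR : ∀ i, i ∈ Finset.range F.length \ L.toFinset ↔ i < F.length ∧ i ∉ L := by simp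
  have hedge' : s(a h, c h) ∈ S 0 := by
    have := hlab h hh
    simpa [this] using hedge
  obtain ⟨s, hs, hsource, V, B, h1, h2, h3, h4, h5, h6, h7, h8, h9, h10, h11⟩ :=
    hS.exists_backbone ((hmemR h).2 ⟨hh, hhL⟩) hedge'
  have hV : ∀ i ∈ V, i < F.length := fun i hi => ((hmemR i).1 (h7 i (h4 i hi))).1
  refine ⟨s, ((hmemR s).1 hs).1, ((hmemR s).1 hs).2, fun j hj => ?_, V, B, h1, hV, h2, h3, h4,
    h5.imp fun _ _ h => h.1, ?_, ?_, ?_, fun i hi => (hmemR i).1 (h7 i hi), h8, h9, h10, ?_⟩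
  · by_contra hjL
    exact hsource j ((hmemR j).2 ⟨hj.choose, hjL⟩) hj
  · rw [hunder V hV]
    simpa using h6
  · rw [hunder V hV]
    exact (List.isChain_map _).2 (h5.imp fun _ _ h => h.2)
  · rintro rfl
    simp at h8
  · rw [hunder V hV, List.length_map]
    exact h11

end
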